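/- Let k ≥ 2 and d ≥ 2, and let f be an automorphism of H_{k,d} such that for each 1 ≤ i ≤ k the element f(z_i) is conjugate in H_{k,d} to z_i, and such that f(x) = x for all x ∈ N. Then f is an inner automorphism of H_{k,d}. -/

import Mathlib

/-- `H_{k,d}`, the free product of `k` copies of the cyclic group `ℤ/dℤ`. -/
abbrev Hkd (k d : ℕ) : Type := Monoid.CoprodI (fun _ : Fin k => Multiplicative (ZMod d))

/-- The generator `z_i` of the `i`-th free factor of `H_{k,d}`. -/
def zgen (k d : ℕ) (i : Fin k) : Hkd k d :=
  Monoid.CoprodI.of (i := i) (Multiplicative.ofAdd (1 : ZMod d))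

/-- The homomorphism `H_{k,d} → ℤ/dℤ` sending each `z_i` to `1`. -/
def projH (k d : ℕ) : Hkd k d →* Multiplicative (ZMod d) :=
  Monoid.CoprodI.lift (fun _ => MonoidHom.id (Multiplicative (ZMod d)))

open Monoid.CoprodI in
theorem neword_head_eq {ι : Type*} {G : ι → Type*} [∀ i, Group (G i)]
    {i j p q : ι} (w : NeWord G i j) (v : NeWord G p q) (h : w.prod = v.prod) :
    (⟨i, w.head⟩ : Σ i, G i) = ⟨p, v.head⟩ := by
  classical
  have h1 : w.toWord = v.toWord := by
    apply (Word.equiv (M := G)).symm.injective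
    exact h
  have h2 : w.toList = v.toList := congrArg Word.toList h1
  have h3 := w.toList_head?
  rw [h2, v.toList_head?] at h3
  exact (Option.some.inj h3).symm

open Monoid.CoprodI in
theorem exists_neword {ι : Type*} {G : ι → Type*} [∀ i, Group (G i)]
    (c : Monoid.CoprodI G) (hc : c ≠ 1) :
    ∃ (i j : ι) (w : NeWord G i j), w.prod = c := by
  classical
  have h : Word.equiv c ≠ Word.empty := by
    intro h
    apply hc
    have := congrArg (Word.equiv (M := G)).symm h
    rw [Equiv.symm_apply_apply] at this
    rw [this]
    exact Word.prod_empty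
  obtain ⟨i, j, w, hw⟩ := NeWord.of_word _ h
  refine ⟨i, j, w, ?_⟩
  unfold NeWord.prod
  rw [hw]
  exact (Word.equiv (M := G)).symm_apply_apply c

open Monoid.CoprodI in
/-- The centralizer criterion: no commuting with suitable words. -/
theorem not_commute_words {ι : Type*} {G : ι → Type*} [∀ i, Group (G i)]
    {i j p q : ι} (w : NeWord G i j) (v : NeWord G p q) (hjp : j ≠ p) (hqi : q ≠ i)
    (hne : (⟨i, w.head⟩ : Σ i, G i) ≠ ⟨p, v.head⟩) :
    w.prod * v.prod ≠ v.prod * w.prod := by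
  intro h
  have := neword_head_eq (NeWord.append w hjp v) (NeWord.append v hqi w)
    (by rw [NeWord.append_prod, NeWord.append_prod, h])
  exact hne this

open Monoid.CoprodI in
theorem centralizer_trivial (k d : ℕ) (hk : 2 ≤ k) (hd : 2 ≤ d) (hkd : 3 ≤ k ∨ 3 ≤ d)
    (c : Hkd k d) (hc : ∀ n ∈ (projH k d).ker, c * n = n * c) : c = 1 := by
  by_contra hne
  obtain ⟨i, j, w, rfl⟩ := exists_neword c hne
  have h1 : (1 : ZMod d) ≠ 0 := by
    haveI : Fact (1 < d) := ⟨hd⟩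
    exact one_ne_zero
  have ho : Multiplicative.ofAdd (1 : ZMod d) ≠ 1 := fun h => h1 (Multiplicative.ofAdd.injective h)
  have ker2 : ∀ (p q : Fin k) (a b : Multiplicative (ZMod d)), a * b = 1 →
      (of (M := fun _ : Fin k => Multiplicative (ZMod d)) (i := p) a * of (i := q) b)
        ∈ (projH k d).ker := by
    intro p q a b hab
    rw [MonoidHom.mem_ker, map_mul]
    simp only [projH, lift_of]
    exact hab
  by_cases hij : ∃ p : Fin k, p ≠ i ∧ p ≠ j ∧ ∃ q : Fin k, q ≠ i ∧ q ≠ p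
  · obtain ⟨p, hpi, hpj, q, hqi, hqp⟩ := hij
    set v : NeWord (fun _ : Fin k => Multiplicative (ZMod d)) p q :=
      NeWord.append (NeWord.singleton (Multiplicative.ofAdd (1 : ZMod d)) ho) hqp.symm
        (NeWord.singleton (Multiplicative.ofAdd (1 : ZMod d))⁻¹ (inv_ne_one.mpr ho)) with hv
    refine not_commute_words w v hpj.symm hqi ?_ (hc _ ?_)
    · intro h
      exact hpi (congrArg Sigma.fst h).symm
    · rw [hv, NeWord.append_prod, NeWord.prod_singleton, NeWord.prod_singleton]
      exact ker2 _ _ _ _ (mul_inv_cancel _)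
  · have hk3 : ¬ 3 ≤ k := by
      intro hk3
      apply hij
      have e1 : ∃ p : Fin k, p ∉ ({i, j} : Finset (Fin k)) := by
        by_contra! hcon
        have : ({i, j} : Finset (Fin k)) = Finset.univ := Finset.eq_univ_of_forall hcon
        have h2 := congrArg Finset.card this
        have := Finset.card_le_two (a := i) (b := j)
        simp at h2
        omega
      obtain ⟨p, hp⟩ := e1
      have e2 : ∃ q : Fin k, q ∉ ({i, p} : Finset (Fin k)) := by
        by_contra! hcon
        have : ({i, p} : Finset (Fin k)) = Finset.univ := Finset.eq_univ_of_forall hcon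
        have h2 := congrArg Finset.card this
        have := Finset.card_le_two (a := i) (b := p)
        simp at h2
        omega
      obtain ⟨q, hq⟩ := e2
      simp at hp hq
      exact ⟨p, hp.1, hp.2, q, hq.1, hq.2⟩
    have hd3 : 3 ≤ d := by omega
    have h2 : (2 : ZMod d) ≠ 0 := by
      intro h
      have h' : ((2 : ℕ) : ZMod d) = 0 := by exact_mod_cast h
      rw [ZMod.natCast_eq_zero_iff] at h'
      have := Nat.le_of_dvd (by norm_num) h'
      omega
    by_cases hijeq : i = j
    · subst hijeq
      obtain ⟨p, hp⟩ : ∃ p : Fin k, p ≠ i := by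
        haveI : Nontrivial (Fin k) := Fin.nontrivial_iff_two_le.mpr hk
        exact exists_ne i
      have h2' : Multiplicative.ofAdd (-2 : ZMod d) ≠ 1 := fun h =>
        h2 (neg_eq_zero.mp (Multiplicative.ofAdd.injective h))
      set v : NeWord (fun _ : Fin k => Multiplicative (ZMod d)) p p :=
        NeWord.append (NeWord.append
          (NeWord.singleton (i := p) (Multiplicative.ofAdd (1 : ZMod d)) ho) hp
          (NeWord.singleton (i := i) (Multiplicative.ofAdd (1 : ZMod d)) ho)) hp.symm
          (NeWord.singleton (Multiplicative.ofAdd (-2 : ZMod d)) h2') with hv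
      refine not_commute_words w v hp.symm hp ?_ (hc _ ?_)
      · intro h
        exact hp (congrArg Sigma.fst h).symm
      · rw [hv, NeWord.append_prod, NeWord.append_prod, NeWord.prod_singleton,
          NeWord.prod_singleton, NeWord.prod_singleton, MonoidHom.mem_ker, map_mul, map_mul]
        simp only [projH, lift_of]
        change Multiplicative.ofAdd ((1 : ZMod d) + 1 + -2) = 1
        rw [show (1 : ZMod d) + 1 + -2 = 0 by ring]
        rfl
    · obtain ⟨s, hs1, hs⟩ : ∃ s : Multiplicative (ZMod d), s ≠ 1 ∧ s ≠ w.head := by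
        by_cases hw : Multiplicative.ofAdd (1 : ZMod d) = w.head
        · refine ⟨Multiplicative.ofAdd (2 : ZMod d),
            fun h => h2 (Multiplicative.ofAdd.injective h), ?_⟩
          rw [← hw]
          intro h
          have h3 : (2 : ZMod d) = 1 := Multiplicative.ofAdd.injective h
          apply h1
          linear_combination h3
        · exact ⟨_, ho, hw⟩
      set v : NeWord (fun _ : Fin k => Multiplicative (ZMod d)) i j :=
        NeWord.append (NeWord.singleton s hs1) hijeq
          (NeWord.singleton s⁻¹ (inv_ne_one.mpr hs1)) with hv
      refine not_commute_words w v (Ne.symm hijeq) (Ne.symm hijeq) ?_ (hc _ ?_)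
      · intro h
        have h3 := eq_of_heq (Sigma.mk.inj h).2
        exact hs h3.symm
      · rw [hv, NeWord.append_prod, NeWord.prod_singleton, NeWord.prod_singleton]
        exact ker2 _ _ _ _ (mul_inv_cancel _)

theorem dihedral_case (f : MulAut (Hkd 2 2))
    (hconj : ∀ i : Fin 2, IsConj (zgen 2 2 i) (f (zgen 2 2 i)))
    (hN : ∀ x ∈ (projH 2 2).ker, f x = x) :
    ∃ h : Hkd 2 2, ∀ x : Hkd 2 2, f x = h * x * h⁻¹ := by
  obtain ⟨a, ha⟩ : ∃ a, a = zgen 2 2 0 := ⟨_, rfl⟩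
  obtain ⟨b, hb⟩ : ∃ b, b = zgen 2 2 1 := ⟨_, rfl⟩
  have hz : ∀ i, zgen 2 2 i * zgen 2 2 i = 1 := by
    intro i
    unfold zgen
    rw [← map_mul]
    exact map_one _
  have haa : a * a = 1 := ha ▸ hz 0
  have hbb : b * b = 1 := hb ▸ hz 1
  have hai : a⁻¹ = a := inv_eq_of_mul_eq_one_left haa
  have hbi : b⁻¹ = b := inv_eq_of_mul_eq_one_left hbb
  have hmem : ∀ (i : Fin 2) (m : Multiplicative (ZMod 2)),
      (Monoid.CoprodI.of (i := i) m : Hkd 2 2) = 1 ∨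
      (Monoid.CoprodI.of (i := i) m : Hkd 2 2) = a ∨
      (Monoid.CoprodI.of (i := i) m : Hkd 2 2) = b := by
    intro i m
    have hm : m = 1 ∨ m = Multiplicative.ofAdd (1 : ZMod 2) := by
      revert m; decide
    rcases hm with rfl | rfl
    · left; exact map_one _
    · right
      fin_cases i
      · left; rw [ha]; rfl
      · right; rw [hb]; rfl
  obtain ⟨t, ht⟩ : ∃ t, t = a * b := ⟨_, rfl⟩
  have hft : f t = t := by
    apply hN
    rw [MonoidHom.mem_ker, ht, ha, hb, map_mul]
    simp only [projH, zgen, Monoid.CoprodI.lift_of]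
    decide
  have hat : a * t * a⁻¹ = t⁻¹ := by
    rw [ht, mul_inv_rev, hai, hbi, ← mul_assoc, haa, one_mul]
  have hatm : ∀ m : ℤ, a * t ^ m = t ^ (-m) * a := by
    intro m
    have := conj_zpow (i := m) (a := a) (b := t)
    rw [hat, inv_zpow'] at this
    rw [this]; group
  have hbt : b = a * t := by rw [ht, ← mul_assoc, haa, one_mul]
  have hall : ∀ g : Hkd 2 2, ∃ m : ℤ, g = t ^ m ∨ g = t ^ m * a := by
    intro g
    have hA : ∀ x : Hkd 2 2, (∃ m : ℤ, x = t ^ m ∨ x = t ^ m * a) →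
        ∃ m : ℤ, a * x = t ^ m ∨ a * x = t ^ m * a := by
      rintro x ⟨m, rfl | rfl⟩
      · exact ⟨-m, Or.inr (hatm m)⟩
      · refine ⟨-m, Or.inl ?_⟩
        rw [← mul_assoc, hatm, mul_assoc, haa, mul_one]
    have hT : ∀ x : Hkd 2 2, (∃ m : ℤ, x = t ^ m ∨ x = t ^ m * a) →
        ∃ m : ℤ, t * x = t ^ m ∨ t * x = t ^ m * a := by
      rintro x ⟨m, rfl | rfl⟩
      · exact ⟨1 + m, Or.inl (by rw [zpow_one_add])⟩
      · exact ⟨1 + m, Or.inr (by rw [zpow_one_add, mul_assoc])⟩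
    induction g using Monoid.CoprodI.induction_left with
    | one => exact ⟨0, Or.inl (by simp)⟩
    | mul m x ih =>
      rcases hmem _ m with h | h | h
      · rw [h, one_mul]; exact ih
      · rw [h]; exact hA _ ih
      · rw [h, hbt, mul_assoc]; exact hA _ (hT _ ih)
  obtain ⟨g, hg⟩ := isConj_iff.mp (hconj 0)
  rw [← ha] at hg
  have key : ∃ m : ℤ, f a = t ^ m * a * (t ^ m)⁻¹ := by
    obtain ⟨m, rfl | rfl⟩ := hall g
    · exact ⟨m, hg.symm⟩
    · refine ⟨m, ?_⟩
      rw [← hg]; group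
  obtain ⟨m, hm⟩ := key
  have hfb : f b = t ^ m * b * (t ^ m)⁻¹ := by
    rw [hbt, map_mul, hft, hm]; group
  refine ⟨t ^ m, fun x => ?_⟩
  induction x using Monoid.CoprodI.induction_left with
  | one => simp
  | mul n x ih =>
    rw [map_mul, ih]
    rcases hmem _ n with h | h | h
    · rw [h, map_one]; group
    · rw [h, hm]; group
    · rw [h, hfb]; group

/-- **Statement 4.** Let `k ≥ 2`, `d ≥ 2`, and let `f` be an automorphism of `H_{k,d}`
such that each `f(z_i)` is conjugate in `H_{k,d}` to `z_i`, and such that `f` fixes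
pointwise the kernel `N` of the map `H_{k,d} → ℤ/dℤ` sending each `z_i` to `1`.
Then `f` is an inner automorphism. -/
theorem stmt4 (k d : ℕ) (hk : 2 ≤ k) (hd : 2 ≤ d)
    (f : MulAut (Hkd k d))
    (hconj : ∀ i : Fin k, IsConj (zgen k d i) (f (zgen k d i)))
    (hN : ∀ x ∈ (projH k d).ker, f x = x) :
    ∃ h : Hkd k d, ∀ x : Hkd k d, f x = h * x * h⁻¹ := by
  by_cases hkd : 3 ≤ k ∨ 3 ≤ d
  · refine ⟨1, fun x => ?_⟩
    have hc : x⁻¹ * f x = 1 := by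
      apply centralizer_trivial k d hk hd hkd
      intro n hn
      have h1 : f (x * n * x⁻¹) = x * n * x⁻¹ :=
        hN _ ((projH k d).normal_ker.conj_mem n hn x)
      rw [map_mul, map_mul, map_inv, hN n hn] at h1
      have h2 : f x * n = x * n * x⁻¹ * f x := by
        rw [← h1]; group
      rw [mul_assoc, h2]; group
    rw [inv_mul_eq_one] at hc
    simpa using hc.symm
  · obtain rfl : k = 2 := by omega
    obtain rfl : d = 2 := by omega
    exact dihedral_case f hconj hN
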